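/- Let p be a Borel probability measure on S and let k > 0 satisfy p({γ = k}) = 0 and p({γ < k}) > 0. Then inf_{k′ > k} α_p(k′) = α_p(k); that is, the non-decreasing map k′ ↦ α_p(k′) is right-continuous at k. -/

import Mathlib

open MeasureTheory Set Filter Topology
open scoped ENNReal NNReal

/-- The space `S = {I,II} × [0,∞) × ℕ`; `true` stands for Player I,
`false` for Player II. -/
abbrev GameS : Type := Bool × ℝ≥0 × ℕ

/-- `pk p i k n = p({ι = i} ∩ {γ ≥ k} ∩ {ξ = n})`. -/
noncomputable def pk (p : Measure GameS) (i : Bool) (k : ℝ≥0) (n : ℕ) : ℝ :=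
  (p {s : GameS | s.1 = i ∧ k ≤ s.2.1 ∧ s.2.2 = n}).toReal

/-- The generating function `G_i(k,x) = Σ_n p_i(k,n) xⁿ`. -/
noncomputable def Gk (p : Measure GameS) (i : Bool) (k : ℝ≥0) (x : ℝ) : ℝ :=
  ∑' n : ℕ, pk p i k n * x ^ n

/-- The value generating function
`f(k,x) = 1 − G_I(k,0) − G_I(k,1) + G_I(k,x) − G_II(k,1−x)`. -/
noncomputable def vgf (p : Measure GameS) (k : ℝ≥0) (x : ℝ) : ℝ :=
  1 - Gk p true k 0 - Gk p true k 1 + Gk p true k x - Gk p false k (1 - x)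


/-- `α_p(k)`: the smallest fixed point of `f_k` in `[0,1]`. -/
noncomputable def alphaP (p : Measure GameS) (k : ℝ≥0) : ℝ :=
  sInf {x ∈ Set.Icc (0:ℝ) 1 | vgf p k x = x}

section PowerInequalities

lemma chord_pow_le {a x : ℝ} (ha : 0 ≤ a) (hax : a ≤ x) (hx : x ≤ 1) (m : ℕ) :
    (1 - a) * x ^ m ≤ (1 - x) * a ^ m + (x - a) := by
  induction m with
  | zero => simp
  | succ m ih =>
    have h1 := mul_le_mul_of_nonneg_left ih (ha.trans hax)
    have h2 : 0 ≤ (x - a) * (1 - x) * (1 - a ^ m) :=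
      mul_nonneg (mul_nonneg (by linarith) (by linarith))
        (by linarith [pow_le_one₀ (n := m) ha (hax.trans hx)])
    rw [pow_succ, pow_succ]
    nlinarith

/-- The third divided difference of `t ↦ t ^ n` at `0, a, x, 1`, with denominators cleared,
is nonnegative. -/
lemma pow_dividedDifference_nonneg {a x : ℝ} (ha : 0 ≤ a) (hax : a ≤ x) (hx : x ≤ 1) (n : ℕ) :
    0 ≤ a ^ n * (x * (1 - x)) - x ^ n * (a * (1 - a)) + 1 ^ n * (a * x * (x - a))
      - 0 ^ n * ((x - a) * (1 - a) * (1 - x)) := by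
  cases n with
  | zero => apply le_of_eq; ring
  | succ m =>
    have h := mul_nonneg (mul_nonneg ha (ha.trans hax))
      (sub_nonneg.2 (chord_pow_le ha hax hx m))
    rw [zero_pow m.succ_ne_zero, one_pow, pow_succ, pow_succ]
    nlinarith

end PowerInequalities

section GeneratingFunctions

variable (p : Measure GameS) [IsProbabilityMeasure p]

lemma pk_nonneg (p : Measure GameS) (i : Bool) (k : ℝ≥0) (n : ℕ) : 0 ≤ pk p i k n :=
  ENNReal.toReal_nonneg

lemma pk_anti (i : Bool) {k k' : ℝ≥0} (h : k ≤ k') (n : ℕ) : pk p i k' n ≤ pk p i k n :=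
  ENNReal.toReal_mono (measure_ne_top _ _)
    (measure_mono fun _ hs => ⟨hs.1, h.trans hs.2.1, hs.2.2⟩)

lemma measurableSet_active_capacity (i : Bool) (k : ℝ≥0) :
    MeasurableSet {s : GameS | s.1 = i ∧ k ≤ s.2.1} :=
  (measurableSet_eq_fun measurable_fst measurable_const).inter
    ((measurable_fst.comp measurable_snd) measurableSet_Ici)

lemma hasSum_pk (i : Bool) (k : ℝ≥0) :
    HasSum (pk p i k) (p {s : GameS | s.1 = i ∧ k ≤ s.2.1}).toReal := by
  have hU : {s : GameS | s.1 = i ∧ k ≤ s.2.1} =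
      ⋃ n, {s : GameS | s.1 = i ∧ k ≤ s.2.1 ∧ s.2.2 = n} := by
    ext s; simp
  have hm : ∀ n, MeasurableSet {s : GameS | s.1 = i ∧ k ≤ s.2.1 ∧ s.2.2 = n} := by
    intro n
    have h := (measurableSet_active_capacity i k).inter
      (measurableSet_eq_fun (measurable_snd.comp measurable_snd) (measurable_const (a := n)))
    convert h using 1
    ext s
    simp [and_assoc]
  have hd : Pairwise (Function.onFun Disjoint
      fun n : ℕ => {s : GameS | s.1 = i ∧ k ≤ s.2.1 ∧ s.2.2 = n}) := fun a b hab =>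
    Set.disjoint_left.2 fun s hs ht => hab (hs.2.2.symm.trans ht.2.2)
  have hsum := measure_iUnion (μ := p) hd hm
  rw [← hU] at hsum
  have hne : ∑' n, p {s : GameS | s.1 = i ∧ k ≤ s.2.1 ∧ s.2.2 = n} ≠ ∞ :=
    hsum ▸ measure_ne_top _ _
  rw [hsum, ENNReal.tsum_toReal_eq fun n => measure_ne_top _ _]
  exact ENNReal.hasSum_toReal hne

lemma norm_pk_mul_pow_le (p : Measure GameS) (i : Bool) (k : ℝ≥0) {x : ℝ} (hx : x ∈ Icc (0 : ℝ) 1) (n : ℕ) :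
    ‖pk p i k n * x ^ n‖ ≤ pk p i k n := by
  rw [Real.norm_of_nonneg (mul_nonneg (pk_nonneg p i k n) (pow_nonneg hx.1 n))]
  exact mul_le_of_le_one_right (pk_nonneg p i k n) (pow_le_one₀ hx.1 hx.2)

lemma summable_pk_mul_pow (i : Bool) (k : ℝ≥0) {x : ℝ} (hx : x ∈ Icc (0 : ℝ) 1) :
    Summable fun n => pk p i k n * x ^ n :=
  .of_norm_bounded (hasSum_pk p i k).summable (norm_pk_mul_pow_le p i k hx)

lemma Gk_nonneg (p : Measure GameS) (i : Bool) (k : ℝ≥0) {x : ℝ} (hx : 0 ≤ x) :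
    0 ≤ Gk p i k x :=
  tsum_nonneg fun n => mul_nonneg (pk_nonneg p i k n) (pow_nonneg hx n)

lemma continuousOn_Gk (i : Bool) (k : ℝ≥0) : ContinuousOn (Gk p i k) (Icc 0 1) :=
  continuousOn_tsum (fun _ => by fun_prop) (hasSum_pk p i k).summable
    fun n _ hx => norm_pk_mul_pow_le p i k hx n

lemma Gk_one (i : Bool) (k : ℝ≥0) :
    Gk p i k 1 = (p {s : GameS | s.1 = i ∧ k ≤ s.2.1}).toReal := by
  simpa [Gk] using (hasSum_pk p i k).tsum_eq

lemma Gk_true_one_add_Gk_false_one (k : ℝ≥0) :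
    Gk p true k 1 + Gk p false k 1 = 1 - (p {s : GameS | s.2.1 < k}).toReal := by
  have hm : MeasurableSet {s : GameS | s.2.1 < k} :=
    measurableSet_lt (measurable_fst.comp measurable_snd) measurable_const
  have hd : Disjoint {s : GameS | s.1 = true ∧ k ≤ s.2.1} {s : GameS | s.1 = false ∧ k ≤ s.2.1} :=
    Set.disjoint_left.2 fun s hs ht => by simp [hs.1] at ht
  have hU : {s : GameS | s.1 = true ∧ k ≤ s.2.1} ∪ {s : GameS | s.1 = false ∧ k ≤ s.2.1} =
      {s : GameS | s.2.1 < k}ᶜ := by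
    ext s
    cases h : s.1 <;> simp [h]
  rw [Gk_one, Gk_one, ← ENNReal.toReal_add (measure_ne_top _ _) (measure_ne_top _ _),
    ← measure_union hd (measurableSet_active_capacity _ _), hU]
  exact probReal_compl_eq_one_sub hm

lemma Gk_anti (i : Bool) {k k' : ℝ≥0} (h : k ≤ k') {x : ℝ} (hx : x ∈ Icc (0 : ℝ) 1) :
    Gk p i k' x ≤ Gk p i k x :=
  (summable_pk_mul_pow p i k' hx).tsum_le_tsum
    (fun n => mul_le_mul_of_nonneg_right (pk_anti p i h n) (pow_nonneg hx.1 n))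
    (summable_pk_mul_pow p i k hx)

lemma Gk_one_sub_anti (i : Bool) {k k' : ℝ≥0} (h : k ≤ k') {x : ℝ} (hx : x ∈ Icc (0 : ℝ) 1) :
    Gk p i k' 1 - Gk p i k' x ≤ Gk p i k 1 - Gk p i k x := by
  have h1 : (1 : ℝ) ∈ Icc (0 : ℝ) 1 := by simp
  unfold Gk
  rw [← (summable_pk_mul_pow p i k' h1).tsum_sub (summable_pk_mul_pow p i k' hx),
    ← (summable_pk_mul_pow p i k h1).tsum_sub (summable_pk_mul_pow p i k hx)]
  refine ((summable_pk_mul_pow p i k' h1).sub (summable_pk_mul_pow p i k' hx)).tsum_le_tsum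
    (fun n => ?_) ((summable_pk_mul_pow p i k h1).sub (summable_pk_mul_pow p i k hx))
  rw [← mul_sub, ← mul_sub, one_pow]
  exact mul_le_mul_of_nonneg_right (pk_anti p i h n) (sub_nonneg.2 (pow_le_one₀ hx.1 hx.2))

lemma Gk_dividedDifference_nonneg (i : Bool) (k : ℝ≥0) {a x : ℝ}
    (ha : 0 ≤ a) (hax : a ≤ x) (hx : x ≤ 1) :
    0 ≤ Gk p i k a * (x * (1 - x)) - Gk p i k x * (a * (1 - a))
      + Gk p i k 1 * (a * x * (x - a)) - Gk p i k 0 * ((x - a) * (1 - a) * (1 - x)) := by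
  have hs (y : ℝ) (hy : y ∈ Icc (0 : ℝ) 1) (c : ℝ) :
      HasSum (fun n => pk p i k n * y ^ n * c) (Gk p i k y * c) :=
    (summable_pk_mul_pow p i k hy).hasSum.mul_right c
  have h := (((hs a ⟨ha, hax.trans hx⟩ (x * (1 - x))).sub
    (hs x ⟨ha.trans hax, hx⟩ (a * (1 - a)))).add (hs 1 (by simp) (a * x * (x - a)))).sub
    (hs 0 (by simp) ((x - a) * (1 - a) * (1 - x)))
  refine h.nonneg fun n => ?_
  have := mul_nonneg (pk_nonneg p i k n) (pow_dividedDifference_nonneg ha hax hx n)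
  linarith

lemma tendsto_pk {i : Bool} {k : ℝ≥0} (h : p {s : GameS | s.2.1 = k} = 0)
    {u : ℕ → ℝ≥0} (hu : Antitone u) (huk : ∀ m, k < u m) (hlim : Tendsto u atTop (𝓝 k)) (n : ℕ) :
    Tendsto (fun m => pk p i (u m) n) atTop (𝓝 (pk p i k n)) := by
  have hmono : Monotone fun m => {s : GameS | s.1 = i ∧ u m ≤ s.2.1 ∧ s.2.2 = n} :=
    fun a b hab s hs => ⟨hs.1, (hu hab).trans hs.2.1, hs.2.2⟩
  have hU : ⋃ m, {s : GameS | s.1 = i ∧ u m ≤ s.2.1 ∧ s.2.2 = n} =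
      {s : GameS | s.1 = i ∧ k ≤ s.2.1 ∧ s.2.2 = n} \ {s : GameS | s.2.1 = k} := by
    ext s
    simp only [mem_iUnion, mem_ofPred_eq, Set.mem_sdiff]
    constructor
    · rintro ⟨m, h1, h2, h3⟩
      exact ⟨⟨h1, (huk m).le.trans h2, h3⟩, ((huk m).trans_le h2).ne'⟩
    · rintro ⟨⟨h1, h2, h3⟩, h4⟩
      obtain ⟨m, hm⟩ := (hlim.eventually (gt_mem_nhds (lt_of_le_of_ne h2 (Ne.symm h4)))).exists
      exact ⟨m, h1, hm.le, h3⟩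
  have ht := tendsto_measure_iUnion_atTop (μ := p) hmono
  rw [hU, measure_sdiff_null h] at ht
  exact (ENNReal.tendsto_toReal (measure_ne_top _ _)).comp ht

lemma tendsto_Gk {i : Bool} {k : ℝ≥0} (h : p {s : GameS | s.2.1 = k} = 0)
    {u : ℕ → ℝ≥0} (hu : Antitone u) (huk : ∀ m, k < u m) (hlim : Tendsto u atTop (𝓝 k))
    {x : ℝ} (hx : x ∈ Icc (0 : ℝ) 1) :
    Tendsto (fun m => Gk p i (u m) x) atTop (𝓝 (Gk p i k x)) :=
  tendsto_tsum_of_dominated_convergence (hasSum_pk p i k).summable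
    (fun n => (tendsto_pk p h hu huk hlim n).mul_const _)
    (.of_forall fun m n => (norm_pk_mul_pow_le p i (u m) hx n).trans (pk_anti p i (huk m).le n))

end GeneratingFunctions

section ValueGeneratingFunction

variable (p : Measure GameS) [IsProbabilityMeasure p]

lemma vgf_zero (k : ℝ≥0) : vgf p k 0 = (p {s : GameS | s.2.1 < k}).toReal := by
  have := Gk_true_one_add_Gk_false_one p k
  simp only [vgf, sub_zero]
  linarith

lemma vgf_one_le (p : Measure GameS) (k : ℝ≥0) : vgf p k 1 ≤ 1 := by
  have h1 := Gk_nonneg p true k le_rfl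
  have h2 := Gk_nonneg p false k le_rfl
  simp only [vgf, sub_self]
  linarith

lemma one_sub_mem_Icc {x : ℝ} (hx : x ∈ Icc (0 : ℝ) 1) : 1 - x ∈ Icc (0 : ℝ) 1 :=
  ⟨by linarith [hx.2], by linarith [hx.1]⟩

lemma continuousOn_vgf (k : ℝ≥0) : ContinuousOn (vgf p k) (Icc 0 1) :=
  (continuousOn_const.add (continuousOn_Gk p true k)).sub
    ((continuousOn_Gk p false k).comp (by fun_prop) fun _ => one_sub_mem_Icc)

lemma vgf_mono_left {k k' : ℝ≥0} (h : k ≤ k') {x : ℝ} (hx : x ∈ Icc (0 : ℝ) 1) :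
    vgf p k x ≤ vgf p k' x := by
  have h1 := Gk_anti p true h (x := 0) (by simp)
  have h2 := Gk_one_sub_anti p true h hx
  have h3 := Gk_anti p false h (one_sub_mem_Icc hx)
  unfold vgf
  linarith

lemma tendsto_vgf {k : ℝ≥0} (h : p {s : GameS | s.2.1 = k} = 0)
    {u : ℕ → ℝ≥0} (hu : Antitone u) (huk : ∀ m, k < u m) (hlim : Tendsto u atTop (𝓝 k))
    {x : ℝ} (hx : x ∈ Icc (0 : ℝ) 1) :
    Tendsto (fun m => vgf p (u m) x) atTop (𝓝 (vgf p k x)) :=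
  (((tendsto_const_nhds.sub (tendsto_Gk p h hu huk hlim (by simp))).sub
    (tendsto_Gk p h hu huk hlim (by simp))).add (tendsto_Gk p h hu huk hlim hx)).sub
    (tendsto_Gk p h hu huk hlim (one_sub_mem_Icc hx))

lemma bddBelow_fixedPoints (p : Measure GameS) (k : ℝ≥0) :
    BddBelow {x ∈ Icc (0 : ℝ) 1 | vgf p k x = x} :=
  ⟨0, fun _ hx => hx.1.1⟩

lemma exists_fixedPoint_le {k : ℝ≥0} {y : ℝ} (hy : y ∈ Icc (0 : ℝ) 1) (h : vgf p k y ≤ y) :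
    ∃ x ∈ {x ∈ Icc (0 : ℝ) 1 | vgf p k x = x}, x ≤ y := by
  have hsub : Icc 0 y ⊆ Icc (0 : ℝ) 1 := Icc_subset_Icc_right hy.2
  have hc : ContinuousOn (fun x => vgf p k x - x) (Icc 0 y) :=
    ((continuousOn_vgf p k).mono hsub).sub continuousOn_id
  have h0 : 0 ≤ vgf p k 0 := by rw [vgf_zero]; exact ENNReal.toReal_nonneg
  obtain ⟨x, hx, hx0⟩ := intermediate_value_Icc' hy.1 hc
    (show (0 : ℝ) ∈ Icc (vgf p k y - y) (vgf p k 0 - 0) from ⟨by linarith, by linarith⟩)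
  exact ⟨x, ⟨hsub hx, sub_eq_zero.1 hx0⟩, hx.2⟩

lemma alphaP_le {k : ℝ≥0} {y : ℝ} (hy : y ∈ Icc (0 : ℝ) 1) (h : vgf p k y ≤ y) :
    alphaP p k ≤ y := by
  obtain ⟨x, hx, hxy⟩ := exists_fixedPoint_le p hy h
  exact (csInf_le (bddBelow_fixedPoints p k) hx).trans hxy

lemma alphaP_mem (k : ℝ≥0) : alphaP p k ∈ {x ∈ Icc (0 : ℝ) 1 | vgf p k x = x} := by
  have hclosed : IsClosed {x ∈ Icc (0 : ℝ) 1 | vgf p k x = x} := by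
    have := ((continuousOn_vgf p k).sub continuousOn_id).preimage_isClosed_of_isClosed
      isClosed_Icc (isClosed_singleton (x := (0 : ℝ)))
    convert this using 1
    ext x
    simp [sub_eq_zero]
  obtain ⟨x, hx, -⟩ := exists_fixedPoint_le p (k := k) (y := 1) (by simp) (vgf_one_le p k)
  exact hclosed.csInf_mem ⟨x, hx⟩ (bddBelow_fixedPoints p k)

lemma alphaP_mono {k k' : ℝ≥0} (h : k ≤ k') : alphaP p k ≤ alphaP p k' := by
  obtain ⟨hI, hfix⟩ := alphaP_mem p k'
  exact alphaP_le p hI ((vgf_mono_left p h hI).trans hfix.le)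

lemma vgf_dividedDifference_nonneg (k : ℝ≥0) {a x : ℝ}
    (ha : 0 ≤ a) (hax : a ≤ x) (hx : x ≤ 1) :
    0 ≤ vgf p k a * (x * (1 - x)) - vgf p k x * (a * (1 - a))
      + vgf p k 1 * (a * x * (x - a)) - vgf p k 0 * ((x - a) * (1 - a) * (1 - x)) := by
  have h1 := Gk_dividedDifference_nonneg p true k ha hax hx
  have h2 := Gk_dividedDifference_nonneg p false k (a := 1 - x) (x := 1 - a)
    (by linarith) (by linarith) (by linarith)
  simp only [vgf, sub_zero, sub_self]
  linarith

/-- Past a fixed point, the value generating function lies strictly below the diagonal. -/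
lemma vgf_lt_self_of_fixedPoint_lt {k : ℝ≥0} (h : 0 < p {s : GameS | s.2.1 < k}) {a x : ℝ}
    (ha : 0 ≤ a) (hfix : vgf p k a = a) (hax : a < x) (hx : x < 1) : vgf p k x < x := by
  have h0 : 0 < vgf p k 0 := by
    rw [vgf_zero]; exact ENNReal.toReal_pos h.ne' (measure_ne_top _ _)
  have ha' : 0 < a := ha.lt_of_ne fun h' => by subst h'; linarith
  have hd := vgf_dividedDifference_nonneg p k ha hax.le hx.le
  rw [hfix] at hd
  by_contra! hle
  have e1 : 0 ≤ (vgf p k x - x) * (a * (1 - a)) :=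
    mul_nonneg (by linarith) (mul_nonneg ha (by linarith))
  have e2 : 0 ≤ (1 - vgf p k 1) * (a * x * (x - a)) :=
    mul_nonneg (by linarith [vgf_one_le p k])
      (mul_nonneg (mul_nonneg ha (by linarith)) (by linarith))
  have e3 : 0 < vgf p k 0 * ((x - a) * (1 - a) * (1 - x)) :=
    mul_pos h0 (mul_pos (mul_pos (by linarith) (by linarith)) (by linarith))
  linarith

end ValueGeneratingFunction

/-- if `k > 0`, `p({γ = k}) = 0` and `p({γ < k}) > 0`, then
`inf_{k′ > k} α_p(k′) = α_p(k)`, i.e. `k′ ↦ α_p(k′)` is right-continuous at `k`. -/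
theorem alphaP_right_continuous
    (p : Measure GameS) [IsProbabilityMeasure p] (k : ℝ≥0) (hk : 0 < k)
    (h1 : p {s : GameS | s.2.1 = k} = 0)
    (h2 : 0 < p {s : GameS | s.2.1 < k}) :
    sInf (alphaP p '' Set.Ioi k) = alphaP p k := by
  refine le_antisymm (le_of_forall_gt_imp_ge_of_dense fun x hx => ?_)
    (le_csInf (nonempty_Ioi.image _) ?_)
  · suffices H : ∃ k' : ℝ≥0, k < k' ∧ alphaP p k' ≤ x by
      obtain ⟨k', hk', hle⟩ := H
      refine (csInf_le ⟨0, ?_⟩ (mem_image_of_mem (alphaP p) hk')).trans hle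
      rintro _ ⟨l, -, rfl⟩
      exact (alphaP_mem p l).1.1
    rcases le_or_gt 1 x with h | h
    · exact ⟨k + 1, lt_add_of_pos_right k one_pos, (alphaP_mem p _).1.2.trans h⟩
    · obtain ⟨hI, hfix⟩ := alphaP_mem p k
      have hxI : x ∈ Icc (0 : ℝ) 1 := ⟨hI.1.trans hx.le, h.le⟩
      obtain ⟨u, hu, huk, hlim⟩ := exists_seq_strictAnti_tendsto k
      obtain ⟨m, hm⟩ := ((tendsto_vgf p h1 hu.antitone huk hlim hxI).eventually
        (gt_mem_nhds (vgf_lt_self_of_fixedPoint_lt p h2 hI.1 hfix hx h))).exists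
      exact ⟨u m, huk m, alphaP_le p hxI hm.le⟩
  · rintro _ ⟨k', hk', rfl⟩
    exact alphaP_mono p (le_of_lt hk')
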